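/- Fix an integer d ≥ 1 and let N : ℤ × ℤ × ℤ → ℤ be an integer-valued function satisfying hypotheses (H0), (H1), and (H2): N(a, b−1, 1) = 4·N(a−1, b, 0) whenever a ≥ 1, b ≥ 1 and a + 2b = 3d. Then there exists a function K : ℕ → ℚ such that for all integers b ≥ 0 and c ≥ 0 and every integer t with 0 ≤ t ≤ 3d − 1 − 2b − c one has N(3d − 1 − 2b − c − t, b, c) = 2^c · K(b+c) · (C(t,c) + 2·C(t,c−1)), and such that moreover 4·K(λ) is an integer for every λ ∈ ℕ, and K(λ) is an integer for every λ ∈ ℕ with 2λ ≠ 3d. -/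

import Mathlib

/-- The binomial coefficient `C(t, j)` for integers `t` and `j`, equal to
`t choose j` when `t ≥ 0` and `0 ≤ j ≤ t`, and `0` when `j < 0` or `j > t`. -/
def binomC (t j : ℤ) : ℚ :=
  if 0 ≤ j then (t.toNat.choose j.toNat : ℚ) else 0

theorem binomC_zero_right (t : ℤ) : binomC t 0 = 1 := by
  simp [binomC]

theorem binomC_of_neg (t : ℤ) {j : ℤ} (hj : j < 0) : binomC t j = 0 := by
  simp [binomC, hj]

theorem binomC_zero_left {j : ℤ} (hj : 0 < j) : binomC 0 j = 0 := by
  have h : 0 < j.toNat := by omega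
  simp [binomC, hj.le, Nat.choose_eq_zero_of_lt h]

/-- Pascal's rule for `binomC`. -/
theorem binomC_succ_left {t : ℤ} (ht : 0 ≤ t) (j : ℤ) :
    binomC (t + 1) j = binomC t j + binomC t (j - 1) := by
  obtain hj | rfl | hj := lt_trichotomy j 0
  · rw [binomC_of_neg _ hj, binomC_of_neg _ hj, binomC_of_neg _ (by omega), add_zero]
  · rw [binomC_zero_right, binomC_zero_right, binomC_of_neg _ (by omega), add_zero]
  · lift t to ℕ using ht
    obtain ⟨k, rfl⟩ : ∃ k : ℕ, j = k + 1 := ⟨(j - 1).toNat, by omega⟩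
    have h1 : ((t : ℤ) + 1).toNat = t + 1 := by omega
    have h2 : ((k : ℤ) + 1).toNat = k + 1 := by omega
    have h3 : (0 : ℤ) ≤ k + 1 := by omega
    simp only [binomC, h1, h2, h3, if_true, add_sub_cancel_right, Int.natCast_nonneg,
      Int.toNat_natCast, Nat.choose_succ_succ', Nat.cast_add]
    ring

/-- The coefficient `K_d^l` read off from the counts `N`. -/
def recursionCoeff (d : ℤ) (N : ℤ → ℤ → ℤ → ℤ) (l : ℕ) : ℚ :=
  if 2 * (l : ℤ) < 3 * d then N (3 * d - 1 - 2 * l) l 0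
  else if 2 * (l : ℤ) = 3 * d then N 0 (l - 1) 1 / 4 else 0

/-- **Equation (4.4) of the paper together with the integrality of the
coefficients `K_d^λ`.**  If `N : ℤ × ℤ × ℤ → ℤ` is integer-valued and satisfies
(H0), (H1) and (H2), then there are numbers `K λ` with
`N (3d-1-2b-c-t) b c = 2^c · K (b+c) · (C(t,c) + 2·C(t,c-1))`, such that
`4·K λ` is always an integer, and `K λ` is an integer whenever `2λ ≠ 3d`. -/
theorem main_recursion_structure_integrality
    (d : ℤ) (hd : 1 ≤ d) (N : ℤ → ℤ → ℤ → ℤ)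
    (H0 : ∀ a b c : ℤ,
      ¬(0 ≤ a ∧ 0 ≤ b ∧ 0 ≤ c ∧ a + 2 * b + 2 * c ≤ 3 * d ∧
        a + 2 * b + c ≤ 3 * d - 1) → N a b c = 0)
    (H1 : ∀ a b c : ℤ, 0 ≤ a → 0 ≤ b → 0 ≤ c → a + 2 * b + c < 3 * d - 1 →
      N a b c = N (a + 1) b c + 2 * N a (b + 1) (c - 1))
    (H2 : ∀ a b : ℤ, 1 ≤ a → 1 ≤ b → a + 2 * b = 3 * d →
      N a (b - 1) 1 = 4 * N (a - 1) b 0) :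
    ∃ K : ℕ → ℚ,
      (∀ b c : ℤ, 0 ≤ b → 0 ≤ c →
        ∀ t : ℤ, 0 ≤ t → t ≤ 3 * d - 1 - 2 * b - c →
          (N (3 * d - 1 - 2 * b - c - t) b c : ℚ) =
            2 ^ c.toNat * K (b + c).toNat *
              (binomC t c + 2 * binomC t (c - 1))) ∧
      (∀ l : ℕ, ∃ m : ℤ, 4 * K l = (m : ℚ)) ∧
      (∀ l : ℕ, 2 * (l : ℤ) ≠ 3 * d → ∃ m : ℤ, K l = (m : ℚ)) := by
  refine ⟨recursionCoeff d N, ?_, fun l => ?_, fun l hl => ?_⟩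
  · intro b c hb hc t ht
    induction t, ht using Int.leInduction generalizing b c with
    | base =>
      intro hle
      obtain rfl | rfl | hc2 : c = 0 ∨ c = 1 ∨ 2 ≤ c := by omega
      · lift b to ℕ using hb
        have hlt : 2 * (b : ℤ) < 3 * d := by omega
        simp [binomC_zero_right, binomC_of_neg, recursionCoeff, hlt]
      · lift b to ℕ using hb
        have hnat : ((b : ℤ) + 1).toNat = b + 1 := by omega
        have hfour : (N (3 * d - 1 - 2 * b - 1 - 0) b 1 : ℚ) =
            4 * recursionCoeff d N (b + 1) := by
          by_cases hlt : 2 * ((b + 1 : ℕ) : ℤ) < 3 * d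
          · rw [recursionCoeff, if_pos hlt]
            have h := H2 (3 * d - 2 * (b + 1)) (b + 1) (by omega) (by omega) (by ring)
            rw [add_sub_cancel_right] at h
            rw [show 3 * d - 1 - 2 * (b : ℤ) - 1 - 0 = 3 * d - 2 * (b + 1) by ring, h,
              show 3 * d - 1 - 2 * ((b + 1 : ℕ) : ℤ) = 3 * d - 2 * (b + 1) - 1 by
                push_cast; ring]
            push_cast
            ring
          · have heq : 2 * ((b + 1 : ℕ) : ℤ) = 3 * d := by omega
            rw [recursionCoeff, if_neg hlt, if_pos heq,
              show 3 * d - 1 - 2 * (b : ℤ) - 1 - 0 = 0 by omega,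
              show ((b + 1 : ℕ) : ℤ) - 1 = b by omega]
            ring
        rw [hfour, hnat, binomC_zero_left one_pos, sub_self, binomC_zero_right]
        norm_num
        ring
      · rw [H0 _ _ _ (by omega), binomC_zero_left (by omega), binomC_zero_left (by omega)]
        simp
    | succ t ht ih =>
      intro hle
      have hrec := H1 (3 * d - 1 - 2 * b - c - (t + 1)) b c (by omega) hb hc (by omega)
      rw [show 3 * d - 1 - 2 * b - c - (t + 1) + 1 = 3 * d - 1 - 2 * b - c - t by ring] at hrec
      rw [hrec, binomC_succ_left ht, binomC_succ_left ht]
      push_cast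
      rw [ih b c hb hc (by omega)]
      obtain rfl | hc1 : c = 0 ∨ 1 ≤ c := by omega
      · rw [H0 _ _ (0 - 1) (by omega), binomC_of_neg _ (show (0 : ℤ) - 1 < 0 by norm_num),
          binomC_of_neg _ (show (0 : ℤ) - 1 - 1 < 0 by norm_num)]
        simp
      · have h := ih (b + 1) (c - 1) (by omega) (by omega) (by omega)
        rw [show 3 * d - 1 - 2 * (b + 1) - (c - 1) - t = 3 * d - 1 - 2 * b - c - (t + 1) by ring,
          show b + 1 + (c - 1) = b + c by ring] at h
        rw [h, show c.toNat = (c - 1).toNat + 1 by omega, pow_succ]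
        ring
  · unfold recursionCoeff
    split_ifs
    · exact ⟨4 * N (3 * d - 1 - 2 * l) l 0, by push_cast; ring⟩
    · exact ⟨N 0 (l - 1) 1, by ring⟩
    · exact ⟨0, by simp⟩
  · unfold recursionCoeff
    split_ifs
    · exact ⟨_, rfl⟩
    · exact ⟨0, by simp⟩
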